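/- Let G = (V, E) be a finite 2-edge-connected simple graph with at least 3 vertices. Then there exists F ⊆ E with (V, F) 2-edge-connected such that for every function x : E → ℝ with x_e ≥ 0 for all e ∈ E and Σ_{e∈∂E(S)} x_e ≥ 2 for every cut ∅ ⊂ S ⊂ V, one has 2·|F| ≤ 3·Σ_{e∈E} x_e; in particular, the integrality gap of the cut-based linear program for Minimum 2-Edge-Connected Spanning Subgraph is at most 3/2. -/

import Mathlib

def TwoEdgeConnected {V : Type*} [Fintype V] (G : SimpleGraph V) : Prop :=
  2 ≤ Fintype.card V ∧ G.Connected ∧ ∀ e ∈ G.edgeSet, (G.deleteEdges {e}).Connected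

def edgeCut {V : Type*} [Fintype V] [DecidableEq V] (G : SimpleGraph V) [DecidableRel G.Adj]
    (S : Finset V) : Finset (Sym2 V) :=
  G.edgeFinset.filter (fun e => ∃ u, u ∈ S ∧ ∃ v, v ∉ S ∧ e = s(u, v))

/-- `IsNormalOn G S r le p` says that `le` is the ancestor order of a depth-first search tree of
`G` on the vertex set `S`, with root `r` and parent function `p`. -/
structure IsNormalOn {V : Type*} (G : SimpleGraph V) (S : Set V) (r : V) (le : V → V → Prop)
    (p : V → V) : Prop where
  root_mem : r ∈ S
  mem : ∀ a b, le a b → a ∈ S ∧ b ∈ S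
  root_le : ∀ a ∈ S, le r a
  refl : ∀ a ∈ S, le a a
  trans : ∀ a b c, le a b → le b c → le a c
  antisymm : ∀ a b, le a b → le b a → a = b
  chain : ∀ a b c, le a c → le b c → le a b ∨ le b a
  comparable : ∀ a ∈ S, ∀ b ∈ S, G.Adj a b → le a b ∨ le b a
  parent_adj : ∀ v ∈ S, v ≠ r → G.Adj v (p v)
  parent_le : ∀ v ∈ S, v ≠ r → le (p v) v
  le_parent : ∀ v ∈ S, v ≠ r → ∀ u, le u v → u ≠ v → le u (p v)

/-- Adjacency with both ends in `S`. -/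
def AdjWithin {V : Type*} (G : SimpleGraph V) (S : Set V) (a b : V) : Prop :=
  G.Adj a b ∧ a ∈ S ∧ b ∈ S

/-- Two normal trees glue along an edge from the root of the first to the root of the second. -/
theorem IsNormalOn.glue {V : Type*} {G : SimpleGraph V} {S C : Set V} {r c : V}
    {le₁ le₂ : V → V → Prop} {p₁ p₂ : V → V} (h₁ : IsNormalOn G S r le₁ p₁)
    (h₂ : IsNormalOn G C c le₂ p₂) (hd : ∀ a ∈ S, a ∉ C) (hrc : G.Adj r c)
    (hno : ∀ a ∈ S, a ≠ r → ∀ b ∈ C, ¬ G.Adj a b) :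
    ∃ le p, IsNormalOn G (S ∪ C) r le p := by
  classical
  obtain ⟨a1, a2, a3, a4, a5, a6, a7, a8, a9, a10, a11⟩ := h₁
  obtain ⟨b1, b2, b3, b4, b5, b6, b7, b8, b9, b10, b11⟩ := h₂
  have hsymm : ∀ a b, G.Adj a b → G.Adj b a := fun _ _ h => h.symm
  refine ⟨fun a b => le₁ a b ∨ le₂ a b ∨ (a = r ∧ b ∈ C),
    fun v => if v ∈ C then (if v = c then r else p₂ v) else p₁ v, ?_⟩
  constructor <;> grind

/-- Every connected finite vertex set carries a normal tree with any prescribed root. -/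
theorem exists_isNormalOn {V : Type*} [Finite V] (G : SimpleGraph V) (S : Set V) (r : V)
    (hr : r ∈ S) (hS : ∀ u ∈ S, Relation.ReflTransGen (AdjWithin G S) r u) :
    ∃ le p, IsNormalOn G S r le p := by
  induction hn : S.ncard using Nat.strong_induction_on generalizing S r with
  | _ n ih =>
    by_cases hne : ∃ s ∈ S, s ≠ r
    · obtain ⟨s, hs, hsr⟩ := hne
      obtain rfl | ⟨c, ⟨hrc, -, hcS⟩, -⟩ := (hS s hs).cases_head
      · exact absurd rfl hsr
      set C : Set V := {u | Relation.ReflTransGen (AdjWithin G (S \ {r})) c u} with hC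
      have hcC : c ∈ C := Relation.ReflTransGen.refl
      have hCS : ∀ u ∈ C, u ∈ S ∧ u ≠ r := by
        intro u hu
        obtain rfl | ⟨w, -, -, -, hw⟩ := Relation.ReflTransGen.cases_tail hu
        · exact ⟨hcS, hrc.ne'⟩
        · exact hw
      have hstep : ∀ a ∈ C, ∀ b ∈ S, b ≠ r → G.Adj a b → b ∈ C := fun a ha b hb hbr hab =>
        Relation.ReflTransGen.tail ha ⟨hab, hCS a ha, hb, hbr⟩
      have hrC : r ∉ C := fun h => (hCS r h).2 rfl
      have hCconn : ∀ u ∈ C, Relation.ReflTransGen (AdjWithin G C) c u := by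
        intro u hu
        induction hu with
        | refl => exact .refl
        | tail hab hbc ih' => exact ih'.tail ⟨hbc.1, hab, hab.tail hbc⟩
      have hDconn : ∀ u ∈ S \ C, Relation.ReflTransGen (AdjWithin G (S \ C)) r u := by
        rintro u ⟨huS, huC⟩
        have := hS u huS
        induction this with
        | refl => exact .refl
        | @tail a b hab hbc ih' =>
          by_cases hbr : b = r
          · rw [hbr]
          · have haC : a ∉ C := fun h => huC (hstep a h b huS hbr hbc.1)
            exact (ih' hbc.2.1 haC).tail ⟨hbc.1, ⟨hbc.2.1, haC⟩, huS, huC⟩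
      have hlt₁ : (S \ C).ncard < n := hn ▸ Set.ncard_lt_ncard
        ⟨Set.sdiff_subset, fun h => (h hcS).2 hcC⟩ (Set.toFinite S)
      have hlt₂ : C.ncard < n := hn ▸ Set.ncard_lt_ncard
        ⟨fun u hu => (hCS u hu).1, fun h => hrC (h hr)⟩ (Set.toFinite S)
      obtain ⟨le₁, p₁, h₁⟩ := ih _ hlt₁ (S \ C) r ⟨hr, hrC⟩ hDconn rfl
      obtain ⟨le₂, p₂, h₂⟩ := ih _ hlt₂ C c hcC hCconn rfl
      have := h₁.glue h₂ (fun a ha => ha.2) hrc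
        (fun a ha har b hb hab => ha.2 (hstep b hb a ha.1 har hab.symm))
      rwa [Set.sdiff_union_of_subset fun u hu => (hCS u hu).1] at this
    · push Not at hne
      refine ⟨fun a b => a = r ∧ b = r, id, ?_⟩
      constructor <;> grind

/-- Every connected finite graph has a normal spanning tree. -/
theorem SimpleGraph.Connected.exists_isNormalOn {V : Type*} [Finite V] {G : SimpleGraph V}
    (hG : G.Connected) : ∃ r le p, IsNormalOn G Set.univ r le p := by
  obtain ⟨r⟩ := hG.nonempty
  refine ⟨r, _root_.exists_isNormalOn G Set.univ r trivial fun u _ => ?_⟩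
  have := (SimpleGraph.reachable_iff_reflTransGen r u).1 (hG.preconnected r u)
  exact Relation.ReflTransGen.mono (fun a b h => ⟨h, trivial, trivial⟩) _ _ this

/-- A well-founded relation has a kernel: a set containing exactly the elements that no smaller
element of the set hits. -/
theorem WellFounded.exists_kernel {α : Type*} {lt : α → α → Prop} (h : WellFounded lt)
    (Q : α → α → Prop) : ∃ K : Set α, ∀ v, v ∈ K ↔ ∀ u, lt u v → u ∈ K → ¬ Q u v := by
  let P : α → Prop := h.fix (C := fun _ => Prop) fun v ih => ∀ u (hu : lt u v), ih u hu → ¬ Q u v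
  refine ⟨{v | P v}, fun v => ?_⟩
  have hP : P v = ∀ u, lt u v → P u → ¬ Q u v := h.fix_eq _ v
  exact Iff.of_eq hP

/-- An edge `uw` that leaves the subtree above `v` downwards and is not the parent edge of `v`. -/
def BackEdge {V : Type*} [PartialOrder V] (G : SimpleGraph V) (p : V → V) (v u w : V) : Prop :=
  v ≤ u ∧ w < v ∧ G.Adj u w ∧ (u = v → w ≠ p v)

/-- A connected graph has an edge leaving every set which contains `a` but not `b`. -/
theorem SimpleGraph.Connected.exists_adj_leaving {V : Type*} {G : SimpleGraph V}
    (hG : G.Connected) {S : Set V} {a b : V} (ha : a ∈ S) (hb : b ∉ S) :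
    ∃ u ∈ S, ∃ w ∉ S, G.Adj u w := by
  obtain ⟨P⟩ := hG.preconnected a b
  obtain ⟨d, -, h₁, h₂⟩ := P.exists_boundary_dart S ha hb
  exact ⟨_, h₁, _, h₂, d.adj⟩

section Order

variable {V : Type*} [PartialOrder V] {G : SimpleGraph V} {r : V} {p : V → V}

theorem exists_backEdge (h : IsNormalOn G Set.univ r (· ≤ ·) p)
    (hG : ∀ e ∈ G.edgeSet, (G.deleteEdges {e}).Connected) {v : V} (hv : v ≠ r) :
    ∃ u w, BackEdge G p v u w := by
  have hadj := h.parent_adj v trivial hv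
  have hlt : p v < v := lt_of_le_of_ne (h.parent_le v trivial hv) hadj.ne'
  obtain ⟨u, hu, w, hw, huw⟩ := (hG s(v, p v) hadj).exists_adj_leaving
    (S := {u | v ≤ u}) (a := v) (b := p v) le_rfl (not_le_of_gt hlt)
  rw [SimpleGraph.deleteEdges_adj] at huw
  obtain ⟨huw, hne⟩ := huw
  simp only [Set.mem_ofPred_eq] at hu hw
  have hwu : w ≤ u := (h.comparable u trivial w trivial huw).resolve_left
    fun h' => hw (hu.trans h')
  have hwv : w ≤ v := (h.chain w v u hwu hu).resolve_right hw
  refine ⟨u, w, hu, lt_of_le_of_ne hwv fun h' => hw h'.ge, huw, ?_⟩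
  rintro rfl rfl
  exact hne rfl

theorem exists_lowest_backEdge [Finite V] (h : IsNormalOn G Set.univ r (· ≤ ·) p)
    (hG : ∀ e ∈ G.edgeSet, (G.deleteEdges {e}).Connected) {v : V} (hv : v ≠ r) :
    ∃ u w, BackEdge G p v u w ∧ ∀ u' w', BackEdge G p v u' w' → w ≤ w' := by
  obtain ⟨u₀, w₀, h₀⟩ := exists_backEdge h hG hv
  obtain ⟨w, ⟨u, hw⟩, hmin⟩ := (Set.toFinite {w | ∃ u, BackEdge G p v u w}).exists_minimal
    ⟨w₀, u₀, h₀⟩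
  refine ⟨u, w, hw, fun u' w' h' => ?_⟩
  rcases h.chain w w' v hw.2.1.le h'.2.1.le with h'' | h''
  · exact h''
  · exact hmin ⟨u', h'⟩ h''

/-- If every parent edge is bypassed by a back edge in `H`, then `H` minus any edge is connected. -/
theorem connected_deleteEdges_of_bypassed [Finite V] (h : IsNormalOn G Set.univ r (· ≤ ·) p)
    {H : SimpleGraph V} (htree : ∀ v ≠ r, H.Adj v (p v))
    (hback : ∀ v ≠ r, ∃ u w, BackEdge H p v u w) (e : Sym2 V) :
    (H.deleteEdges {e}).Connected := by
  have hlt : ∀ v ≠ r, p v < v := fun v hv =>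
    lt_of_le_of_ne (h.parent_le v trivial hv) (h.parent_adj v trivial hv).ne'
  have hroot : ∀ v, r ≤ v := fun v => h.root_le v trivial
  have key : ∀ v, (H.deleteEdges {e}).Reachable v r := by
    intro v
    induction v using WellFoundedLT.induction with
    | ind v ih =>
      by_cases hv : v = r
      · rw [hv]
      by_cases he : s(v, p v) = e
      · have sub : ∀ u, v ≤ u → (H.deleteEdges {e}).Reachable v u := by
          intro u
          induction u using WellFoundedLT.induction with
          | ind u ihu =>
            intro hvu
            by_cases huv : v = u
            · rw [huv]
            have hur : u ≠ r := by
              rintro rfl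
              exact huv (le_antisymm hvu (hroot v))
            refine (ihu (p u) (hlt u hur) (h.le_parent u trivial hur v hvu huv)).trans
              (SimpleGraph.Adj.reachable ?_)
            rw [SimpleGraph.deleteEdges_adj]
            refine ⟨(htree u hur).symm, ?_⟩
            rw [Set.mem_singleton_iff, ← he, Sym2.eq_iff]
            rintro (⟨h₁, h₂⟩ | ⟨h₁, h₂⟩)
            · exact absurd (hlt v hv) (h₂ ▸ not_lt_of_ge hvu)
            · exact huv h₂.symm
        obtain ⟨u, w, hu, hw, huw, hne⟩ := hback v hv
        refine ((sub u hu).trans (SimpleGraph.Adj.reachable ?_)).trans (ih w hw)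
        rw [SimpleGraph.deleteEdges_adj]
        refine ⟨huw, ?_⟩
        rw [Set.mem_singleton_iff, ← he, Sym2.eq_iff]
        rintro (⟨h₁, h₂⟩ | ⟨h₁, h₂⟩)
        · exact hne h₁ h₂
        · exact hw.ne h₂
      · refine (SimpleGraph.Adj.reachable ?_).trans (ih (p v) (hlt v hv))
        rw [SimpleGraph.deleteEdges_adj]
        exact ⟨htree v hv, he⟩
  exact { preconnected := fun a b => (key a).trans (key b).symm, nonempty := ⟨r⟩ }

/-- The edges from `f k` to `g k`, for `k` in a suitable set `K`, bypass every parent edge, while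
the cuts of the subtrees above the elements of `K` are disjoint. -/
theorem exists_bypassing_edges [Finite V] (h : IsNormalOn G Set.univ r (· ≤ ·) p)
    (hG : ∀ e ∈ G.edgeSet, (G.deleteEdges {e}).Connected) :
    ∃ (K : Set V) (f g : V → V), r ∉ K ∧ (∀ v ∈ K, G.Adj (f v) (g v)) ∧
      (∀ v ≠ r, ∃ k ∈ K, BackEdge G p v (f k) (g k)) ∧
      ∀ v ∈ K, ∀ v' ∈ K, ∀ u w, G.Adj u w → v ≤ u → ¬ v ≤ w →
        ((v' ≤ u ∧ ¬ v' ≤ w) ∨ (v' ≤ w ∧ ¬ v' ≤ u)) → v = v' := by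
  have low : ∀ v, ∃ u w, v ≠ r →
      BackEdge G p v u w ∧ ∀ u' w', BackEdge G p v u' w' → w ≤ w' := by
    intro v
    by_cases hv : v = r
    · exact ⟨v, v, fun h' => absurd hv h'⟩
    · obtain ⟨u, w, huw⟩ := exists_lowest_backEdge h hG hv
      exact ⟨u, w, fun _ => huw⟩
  choose f g hfg using low
  obtain ⟨K, hK⟩ := (wellFounded_gt (α := V)).exists_kernel
    fun v' v => v' ≠ r ∧ g v' < v
  have hroot : ∀ v, r ≤ v := fun v => h.root_le v trivial
  have clash : ∀ v ∈ K, ∀ v' ∈ K, ∀ u w, G.Adj u w → v' ≤ u → w < v → ¬ v < v' := by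
    intro v hv v' hv' u w huw hu hw hlt
    have hr' : v' ≠ r := (lt_of_le_of_lt (hroot v) hlt).ne'
    refine (hK v).1 hv v' hlt hv' ⟨hr', lt_of_le_of_lt ((hfg v' hr').2 u w ?_) hw⟩
    refine ⟨hu, hw.trans hlt, huw, fun _ hwp => ?_⟩
    exact absurd hw (hwp ▸ not_lt_of_ge (h.le_parent v' trivial hr' v hlt.le hlt.ne))
  refine ⟨K \ {r}, f, g, fun h' => h'.2 rfl, fun v hv => (hfg v hv.2).1.2.2.1, ?_, ?_⟩
  · intro v hv
    by_cases hvK : v ∈ K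
    · exact ⟨v, ⟨hvK, hv⟩, (hfg v hv).1⟩
    · rw [hK] at hvK
      push Not at hvK
      obtain ⟨k, hk, hkK, hkr, hgk⟩ := hvK
      have hb := (hfg k hkr).1
      exact ⟨k, ⟨hkK, hkr⟩, hk.le.trans hb.1, hgk, hb.2.2.1,
        fun h' => absurd (h' ▸ hb.1) (not_le_of_gt hk)⟩
  · rintro v ⟨hv, -⟩ v' ⟨hv', -⟩ u w huw hvu hvw hcross
    have hwu : w ≤ u := (h.comparable u trivial w trivial huw).resolve_left
      fun h' => hvw (hvu.trans h')
    have hwv : w < v := lt_of_le_not_ge ((h.chain w v u hwu hvu).resolve_right hvw) hvw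
    obtain ⟨hvu', hvw'⟩ : v' ≤ u ∧ ¬ v' ≤ w :=
      hcross.resolve_right fun h' => h'.2 (h'.1.trans hwu)
    have hwv' : w < v' :=
      lt_of_le_not_ge ((h.chain w v' u hwu hvu').resolve_right hvw') hvw'
    by_contra hne
    rcases h.chain v v' u hvu hvu' with h' | h'
    · exact clash v hv v' hv' u w huw hvu' hwv (lt_of_le_of_ne h' hne)
    · exact clash v' hv' v hv u w huw hvu hwv' (lt_of_le_of_ne h' (Ne.symm hne))

end Order

section Cuts

variable {V : Type*} [Fintype V] [DecidableEq V] {G : SimpleGraph V} [DecidableRel G.Adj]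

theorem mem_edgeCut {S : Finset V} {u w : V} :
    s(u, w) ∈ edgeCut G S ↔ G.Adj u w ∧ ((u ∈ S ∧ w ∉ S) ∨ (w ∈ S ∧ u ∉ S)) := by
  simp only [edgeCut, Finset.mem_filter, SimpleGraph.mem_edgeFinset, SimpleGraph.mem_edgeSet,
    Sym2.eq_iff]
  grind

/-- Pairwise disjoint cuts bound the value of a feasible point from below. -/
theorem two_mul_card_le_of_disjoint_cuts {x : Sym2 V → ℝ} (hx : ∀ e ∈ G.edgeFinset, 0 ≤ x e)
    (hcut : ∀ S : Finset V, S.Nonempty → S ≠ Finset.univ → 2 ≤ ∑ e ∈ edgeCut G S, x e)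
    {ι : Type*} (K : Finset ι) (D : ι → Finset V) (hne : ∀ i ∈ K, (D i).Nonempty)
    (huniv : ∀ i ∈ K, D i ≠ Finset.univ)
    (hdisj : (K : Set ι).PairwiseDisjoint fun i => edgeCut G (D i)) :
    2 * (K.card : ℝ) ≤ ∑ e ∈ G.edgeFinset, x e := by
  classical
  calc 2 * (K.card : ℝ) = ∑ i ∈ K, (2 : ℝ) := by simp [mul_comm]
    _ ≤ ∑ i ∈ K, ∑ e ∈ edgeCut G (D i), x e :=
        Finset.sum_le_sum fun i hi => hcut _ (hne i hi) (huniv i hi)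
    _ = ∑ e ∈ K.biUnion fun i => edgeCut G (D i), x e := (Finset.sum_biUnion hdisj).symm
    _ ≤ ∑ e ∈ G.edgeFinset, x e := by
        refine Finset.sum_le_sum_of_subset_of_nonneg ?_ fun e he _ => hx e he
        exact Finset.biUnion_subset.2 fun i _ => Finset.filter_subset _ _

/-- The degree cuts bound the value of a feasible point from below. -/
theorem card_le_of_degree_cuts {x : Sym2 V → ℝ} (hx : ∀ e ∈ G.edgeFinset, 0 ≤ x e)
    (hcut : ∀ S : Finset V, S.Nonempty → S ≠ Finset.univ → 2 ≤ ∑ e ∈ edgeCut G S, x e)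
    (hcard : 2 ≤ Fintype.card V) :
    (Fintype.card V : ℝ) ≤ ∑ e ∈ G.edgeFinset, x e := by
  have h₁ : ∑ v : V, (2 : ℝ) ≤ ∑ v : V, ∑ e ∈ edgeCut G {v}, x e := by
    refine Finset.sum_le_sum fun v _ => hcut _ (Finset.singleton_nonempty v) fun h => ?_
    have := congrArg Finset.card h
    rw [Finset.card_singleton, Finset.card_univ] at this
    omega
  have h₂ : ∑ v : V, ∑ e ∈ edgeCut G {v}, x e ≤ ∑ e ∈ G.edgeFinset, 2 * x e := by
    simp only [edgeCut, Finset.sum_filter]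
    rw [Finset.sum_comm]
    refine Finset.sum_le_sum fun e he => ?_
    rw [← Finset.sum_filter, Finset.sum_const, nsmul_eq_mul]
    refine mul_le_mul_of_nonneg_right ?_ (hx e he)
    induction e using Sym2.ind with
    | _ a b =>
      refine le_trans ?_ (Nat.cast_le.2 (Finset.card_le_two (a := a) (b := b)))
      refine Nat.cast_le.2 (Finset.card_le_card fun v hv => ?_)
      simp only [Finset.mem_filter, Finset.mem_univ, true_and, Finset.mem_singleton,
        Sym2.eq_iff] at hv
      grind
  rw [← Finset.mul_sum] at h₂
  simp only [Finset.sum_const, Finset.card_univ, nsmul_eq_mul] at h₁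
  linarith

end Cuts

theorem stmt18 {V : Type*} [Fintype V] [DecidableEq V]
    (G : SimpleGraph V) [DecidableRel G.Adj]
    (hG : TwoEdgeConnected G) (hcard : 3 ≤ Fintype.card V) :
    ∃ F ⊆ G.edgeFinset,
      TwoEdgeConnected (SimpleGraph.fromEdgeSet (F : Set (Sym2 V))) ∧
      ∀ x : Sym2 V → ℝ, (∀ e ∈ G.edgeFinset, 0 ≤ x e) →
        (∀ S : Finset V, S.Nonempty → S ≠ Finset.univ →
          2 ≤ ∑ e ∈ edgeCut G S, x e) →
        2 * (F.card : ℝ) ≤ 3 * ∑ e ∈ G.edgeFinset, x e := by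
  classical
  obtain ⟨hV, hconn, hdel⟩ := hG
  obtain ⟨r, le, p, h⟩ := hconn.exists_isNormalOn
  let _ : PartialOrder V :=
    { le := le
      le_refl := fun a => h.refl a trivial
      le_trans := h.trans
      le_antisymm := h.antisymm }
  replace h : IsNormalOn G Set.univ r (· ≤ ·) p := h
  obtain ⟨K, f, g, hrK, hKadj, hback, hdisj⟩ := exists_bypassing_edges h hdel
  set T : Finset (Sym2 V) := (Finset.univ.erase r).image fun v => s(v, p v) with hT
  set B : Finset (Sym2 V) := K.toFinset.image fun v => s(f v, g v) with hB
  have hTG : ∀ v ≠ r, G.Adj v (p v) := fun v hv => h.parent_adj v trivial hv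
  have hadjT : ∀ v ≠ r, (SimpleGraph.fromEdgeSet ((T ∪ B : Finset _) : Set (Sym2 V))).Adj
      v (p v) := by
    intro v hv
    rw [SimpleGraph.fromEdgeSet_adj]
    refine ⟨Finset.mem_union_left _ (Finset.mem_image.2 ⟨v, ?_, rfl⟩), (hTG v hv).ne⟩
    exact Finset.mem_erase.2 ⟨hv, Finset.mem_univ v⟩
  have hadjB : ∀ v ≠ r, ∃ u w, BackEdge
      (SimpleGraph.fromEdgeSet ((T ∪ B : Finset _) : Set (Sym2 V))) p v u w := by
    intro v hv
    obtain ⟨k, hk, h₁, h₂, h₃, h₄⟩ := hback v hv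
    refine ⟨f k, g k, h₁, h₂, ?_, h₄⟩
    rw [SimpleGraph.fromEdgeSet_adj]
    refine ⟨Finset.mem_union_right _ (Finset.mem_image.2 ⟨k, ?_, rfl⟩), h₃.ne⟩
    exact Set.mem_toFinset.2 hk
  have hdelF := connected_deleteEdges_of_bypassed h hadjT hadjB
  refine ⟨T ∪ B, ?_, ⟨hV, ?_, fun e _ => hdelF e⟩, ?_⟩
  · intro e he
    rw [SimpleGraph.mem_edgeFinset]
    rcases Finset.mem_union.1 he with he | he
    · obtain ⟨v, hv, rfl⟩ := Finset.mem_image.1 he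
      exact hTG v (Finset.ne_of_mem_erase hv)
    · obtain ⟨v, hv, rfl⟩ := Finset.mem_image.1 he
      exact hKadj v (Set.mem_toFinset.1 hv)
  · exact (hdelF s(r, r)).mono (SimpleGraph.deleteEdges_le _)
  · intro x hx hcut
    have hn := card_le_of_degree_cuts hx hcut hV
    have hk := two_mul_card_le_of_disjoint_cuts hx hcut K.toFinset
      (fun v => Finset.univ.filter (v ≤ ·)) (fun v _ => ⟨v, by simp⟩)
      (fun v hv huniv => by
        have hr : r ∈ Finset.univ.filter (v ≤ ·) := by
          rw [huniv]
          exact Finset.mem_univ r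
        have hvr : v = r := le_antisymm (by simpa using hr) (h.root_le v trivial)
        exact hrK (hvr ▸ Set.mem_toFinset.1 hv))
      (fun v hv v' hv' hne => by
        rw [Finset.mem_coe, Set.mem_toFinset] at hv hv'
        refine Finset.disjoint_left.2 fun e => ?_
        induction e using Sym2.ind with
        | _ a b =>
          simp only [mem_edgeCut, Finset.mem_filter, Finset.mem_univ, true_and]
          rintro ⟨hab, ⟨h₁, h₂⟩ | ⟨h₁, h₂⟩⟩ ⟨-, h₃⟩
          · exact hne (hdisj v hv v' hv' a b hab h₁ h₂ h₃)
          · exact hne (hdisj v hv v' hv' b a hab.symm h₁ h₂ h₃.symm))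
    have hTcard : T.card + 1 ≤ Fintype.card V := by
      have h₁ : T.card ≤ (Finset.univ.erase r).card := Finset.card_image_le
      rw [Finset.card_erase_of_mem (Finset.mem_univ r), Finset.card_univ] at h₁
      omega
    have hF : (T ∪ B).card ≤ Fintype.card V + K.toFinset.card := by
      have h₁ := Finset.card_union_le T B
      have h₂ : B.card ≤ K.toFinset.card := Finset.card_image_le
      omega
    have hF' : ((T ∪ B).card : ℝ) ≤ Fintype.card V + K.toFinset.card := by exact_mod_cast hF
    linarith
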